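/- A transitive subshift is language stable if and only if it is entropy stable. -/

import Mathlib

open Filter Topology MeasureTheory Set

def shiftMap (A : Type*) : (ℤ → A) → (ℤ → A) := fun x n => x (n + 1)

def occursAt {A : Type*} (x : ℤ → A) (i : ℤ) (w : List A) : Prop :=
  ∀ j : Fin w.length, x (i + (j : ℕ)) = w.get j

def inLang {A : Type*} (X : Set (ℤ → A)) (w : List A) : Prop :=
  ∃ x ∈ X, occursAt x 0 w

def sftCover {A : Type*} (X : Set (ℤ → A)) (n : ℕ) : Set (ℤ → A) :=
  { x | ∀ (i : ℤ) (w : List A), w.length ≤ n → occursAt x i w → inLang X w }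

def IsSubshift {A : Type*} [TopologicalSpace A] (X : Set (ℤ → A)) : Prop :=
  X.Nonempty ∧ IsClosed X ∧ shiftMap A '' X = X

def minPeriodPts {A : Type*} (S : Set (ℤ → A)) (p : ℕ) : Set (ℤ → A) :=
  { x ∈ S | (shiftMap A)^[p] x = x ∧ ∀ q : ℕ, 0 < q → q < p → (shiftMap A)^[q] x ≠ x }

def PeriodStable {A : Type*} (X : Set (ℤ → A)) : Prop :=
  ∀ m : ℕ, ∃ n p : ℕ, 0 < p ∧
    minPeriodPts (sftCover X n) p = minPeriodPts (sftCover X (n + m)) p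

def LanguageStable {A : Type*} (X : Set (ℤ → A)) : Prop :=
  ∀ m : ℕ, ∃ n : ℕ, sftCover X n = sftCover X (n + m)

def TopMixing {A : Type*} (X : Set (ℤ → A)) : Prop :=
  ∀ u v : List A, inLang X u → inLang X v →
    ∃ N : ℕ, ∀ n ≥ N, ∃ w : List A, w.length = n ∧ inLang X (u ++ w ++ v)

def LangTransitive {A : Type*} (X : Set (ℤ → A)) : Prop :=
  ∀ u v : List A, inLang X u → inLang X v → ∃ w : List A, inLang X (u ++ w ++ v)

def globalSlide {A : Type*} (R : ℕ) (Φ : List A → A) : (ℤ → A) → (ℤ → A) :=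
  fun x i => Φ (List.ofFn (fun j : Fin (2 * R + 1) => x (i - R + (j : ℕ))))

def wordSlide {A : Type*} (R : ℕ) (Φ : List A → A) (w : List A) : List A :=
  (List.range (w.length - 2 * R)).map (fun j => Φ ((w.drop j).take (2 * R + 1)))

noncomputable def subshiftEntropy {A : Type*} (X : Set (ℤ → A)) : ℝ :=
  Filter.limsup
    (fun n : ℕ => Real.log (Nat.card { w : List A // w.length = n ∧ inLang X w }) / n)
    Filter.atTop

def IsNNSFT {A : Type*} (X : Set (ℤ → A)) : Prop :=
  ∃ F : Set (List A), (∀ w ∈ F, w.length ≤ 2) ∧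
    X = { x | ∀ (i : ℤ) (w : List A), w ∈ F → ¬ occursAt x i w }

noncomputable def xi (s : ℕ) : ℝ :=
  30 * (s : ℝ) ^ (3 * (s ^ 2 + 1)) /
    (1 - Real.rpow (1 - 1 / (4 * (s : ℝ) ^ (2 * s ^ 2))) (1 / (s ^ 2 : ℝ)))

noncomputable def measEntropy {A : Type*} [Fintype A] [MeasurableSpace A]
    (μ : MeasureTheory.Measure (ℤ → A)) : ℝ :=
  Filter.limsup
    (fun n : ℕ =>
      (∑ w : Fin n → A,
        Real.negMulLog ((μ { x : ℤ → A | ∀ j : Fin n, x ((j : ℕ) : ℤ) = w j }).toReal)) / n)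
    Filter.atTop

def EntropyStable {A : Type*} [Fintype A] (X : Set (ℤ → A)) : Prop :=
  ∀ ε : ℝ, 0 < ε → ∀ ℓ j : ℕ, 1 ≤ ℓ → 1 ≤ j →
    ∃ m : ℕ,
      |subshiftEntropy (sftCover X m) - subshiftEntropy (sftCover X (m + j))| <
        ε ^ 2 / ((4 / 3 : ℝ) ^ (2 * ℓ) *
          (xi (Nat.card { w : List A // w.length = m ∧ inLang (sftCover X m) w })) ^ 2)

theorem occursAt_iff {A : Type*} {x : ℤ → A} {i : ℤ} {w : List A} :
    occursAt x i w ↔ ∀ (j : ℕ) (h : j < w.length), x (i + j) = w[j] :=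
  ⟨fun h j hj => h ⟨j, hj⟩, fun h j => h j j.2⟩

theorem occursAt_append {A : Type*} {x : ℤ → A} {i : ℤ} {u v : List A} :
    occursAt x i (u ++ v) ↔ occursAt x i u ∧ occursAt x (i + u.length) v := by
  simp only [occursAt_iff]
  refine ⟨fun h => ⟨fun j hj => ?_, fun j hj => ?_⟩, fun h j hj => ?_⟩
  · rw [h j (by simp; omega), List.getElem_append_left]
  · have := h (u.length + j) (by simp; omega)
    rw [List.getElem_append_right (by omega)] at this
    simpa [add_assoc] using this
  · by_cases hju : j < u.length
    · rw [List.getElem_append_left hju, h.1 j hju]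
    · rw [List.getElem_append_right (by omega), ← h.2 (j - u.length) (by simp at hj; omega)]
      congr 1
      push_cast [not_lt.1 hju]
      ring

theorem occursAt_shift {A : Type*} {x : ℤ → A} {i k : ℤ} {w : List A} :
    occursAt (fun l => x (l + k)) i w ↔ occursAt x (i + k) w := by
  simp only [occursAt_iff, add_right_comm]

theorem occursAt_ofFn {A : Type*} (x : ℤ → A) (i : ℤ) (k : ℕ) :
    occursAt x i (List.ofFn fun j : Fin k => x (i + (j : ℕ))) := by
  simp [occursAt_iff]

def ShiftInvariant {A : Type*} (S : Set (ℤ → A)) : Prop :=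
  ∀ x ∈ S, ∀ k : ℤ, (fun l => x (l + k)) ∈ S

theorem ShiftInvariant.inLang_of_occursAt {A : Type*} {S : Set (ℤ → A)} (hS : ShiftInvariant S)
    {x : ℤ → A} (hx : x ∈ S) {i : ℤ} {w : List A} (h : occursAt x i w) : inLang S w :=
  ⟨_, hS x hx i, occursAt_shift.2 (by simpa using h)⟩

theorem ShiftInvariant.inLang_of_infix {A : Type*} {S : Set (ℤ → A)} (hS : ShiftInvariant S)
    {u v : List A} (hu : inLang S u) (h : v <:+: u) : inLang S v := by
  obtain ⟨x, hx, hxu⟩ := hu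
  obtain ⟨a, b, rfl⟩ := h
  exact hS.inLang_of_occursAt hx (occursAt_append.1 (occursAt_append.1 hxu).1).2

theorem shiftInvariant_sftCover {A : Type*} (X : Set (ℤ → A)) (n : ℕ) :
    ShiftInvariant (sftCover X n) :=
  fun _ hx _ _ w hw h => hx _ w hw (occursAt_shift.1 h)

theorem shiftInvariant_of_image_eq {A : Type*} {X : Set (ℤ → A)} (h : shiftMap A '' X = X) :
    ShiftInvariant X := by
  intro x hx k
  induction k using Int.induction_on with
  | zero => simpa using hx
  | succ k ih =>
    rw [← h]
    refine ⟨_, ih, ?_⟩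
    funext l
    simp only [shiftMap]
    congr 1
    ring
  | pred k ih =>
    rw [← h] at ih
    obtain ⟨y, hy, hyx⟩ := ih
    convert hy using 1
    funext l
    have := congrFun hyx (l - 1)
    simp only [shiftMap] at this
    rw [sub_add_cancel] at this
    rw [this]
    congr 1
    ring

theorem subset_sftCover {A : Type*} {X : Set (ℤ → A)} (hX : ShiftInvariant X) (n : ℕ) :
    X ⊆ sftCover X n :=
  fun _ hx _ _ _ h => hX.inLang_of_occursAt hx h

theorem inLang_of_inLang_sftCover {A : Type*} {X : Set (ℤ → A)} {n : ℕ} {w : List A}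
    (hw : w.length ≤ n) (h : inLang (sftCover X n) w) : inLang X w := by
  obtain ⟨x, hx, hxw⟩ := h
  exact hx 0 w hw hxw

theorem inLang_sftCover_append {A : Type*} {X : Set (ℤ → A)} {n : ℕ} {u v t : List A}
    (hv : v.length = n) (h₁ : inLang (sftCover X n) (u ++ v))
    (h₂ : inLang (sftCover X n) (v ++ t)) : inLang (sftCover X n) (u ++ v ++ t) := by
  obtain ⟨x, hx, hxu⟩ := h₁
  obtain ⟨z, hz, hzt⟩ := h₂
  have hxv := occursAt_iff.1 (occursAt_append.1 hxu).2
  have hzv := occursAt_iff.1 (occursAt_append.1 hzt).1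
  have key : ∀ k : ℤ, (u.length : ℤ) ≤ k →
      (if k < u.length + n then x k else z (k - u.length)) = z (k - u.length) := by
    intro k hk
    split_ifs with hkn
    · obtain ⟨j, rfl⟩ := Int.le.dest hk
      have hj : j < v.length := by omega
      have e₁ := hxv j hj
      have e₂ := hzv j hj
      rw [zero_add] at e₁ e₂
      rw [e₁, add_sub_cancel_left, e₂]
    · rfl
  refine ⟨fun k => if k < u.length + n then x k else z (k - u.length), ?_, ?_⟩
  · intro i w hw h
    rw [occursAt_iff] at h
    by_cases hi : i < u.length
    · refine hx i w hw (occursAt_iff.2 fun j hj => ?_)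
      rw [← h j hj, if_pos (by omega)]
    · refine hz (i - u.length) w hw (occursAt_iff.2 fun j hj => ?_)
      rw [← h j hj, key _ (by omega)]
      congr 1
      ring
  · rw [occursAt_append]
    constructor
    · rw [occursAt_iff] at hxu ⊢
      intro j hj
      rw [← hxu j hj, if_pos (by simp at hj; omega)]
    · have := occursAt_iff.1 (occursAt_append.1 hzt).2
      rw [occursAt_iff]
      intro j hj
      rw [← this j hj, key _ (by simp; omega)]
      congr 1
      push_cast [List.length_append]
      ring

theorem finite_words {A : Type*} [Finite A] (S : Set (ℤ → A)) (n : ℕ) :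
    Finite { w : List A // w.length = n ∧ inLang S w } :=
  ((List.finite_length_eq A n).subset fun _ h => h.1).to_subtype

theorem exists_short_path {A : Type*} [Finite A] {X : Set (ℤ → A)} {n : ℕ} {v v' : List A}
    (hv : v.length = n) (hv' : v'.length = n)
    (h : ∃ u, inLang (sftCover X n) u ∧ v <+: u ∧ v' <:+ u) :
    ∃ u, inLang (sftCover X n) u ∧ v <+: u ∧ v' <:+ u ∧
      u.length < Nat.card { w : List A // w.length = n ∧ inLang (sftCover X n) w } + n := by
  have := finite_words (sftCover X n) n
  have hS := shiftInvariant_sftCover X n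
  obtain ⟨u, ⟨hu, hvu, hvu'⟩, hmin⟩ := exists_minimalFor_of_wellFoundedLT
    (fun u => inLang (sftCover X n) u ∧ v <+: u ∧ v' <:+ u) List.length h
  refine ⟨u, hu, hvu, hvu', ?_⟩
  by_contra! hlen
  have hnu : n ≤ u.length := hv ▸ hvu.length_le
  let f : Fin (u.length - n + 1) → { w : List A // w.length = n ∧ inLang (sftCover X n) w } :=
    fun i => ⟨(u.drop i).take n, by simp; omega,
      hS.inLang_of_infix hu ((List.take_prefix _ _).isInfix.trans (List.drop_suffix _ _).isInfix)⟩
  have hf : ¬ Function.Injective f := fun hf => by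
    have := Nat.card_le_card_of_injective f hf
    simp at this
    omega
  obtain ⟨i, j, hij, hlt⟩ : ∃ i j, f i = f j ∧ i < j := by
    simp only [Function.Injective, not_forall] at hf
    obtain ⟨i, j, hij, hne⟩ := hf
    rcases lt_or_gt_of_ne hne with h | h
    exacts [⟨i, j, hij, h⟩, ⟨j, i, hij.symm, h⟩]
  have hij : (u.drop i).take n = (u.drop j).take n := congrArg Subtype.val hij
  have hlt : (i : ℕ) < j := hlt
  have hj : (j : ℕ) ≤ u.length - n := by omega
  have ei : u.take i ++ (u.drop i).take n = u.take (i + n) := by rw [List.take_add]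
  have ej : (u.drop j).take n ++ u.drop (j + n) = u.drop j := by
    rw [← List.drop_drop, List.take_append_drop]
  have hmem : inLang (sftCover X n) (u.take i ++ (u.drop i).take n ++ u.drop (j + n)) := by
    refine inLang_sftCover_append (by simp; omega) ?_ ?_
    · rw [ei]
      exact hS.inLang_of_infix hu (List.take_prefix _ _).isInfix
    · rw [hij, ej]
      exact hS.inLang_of_infix hu (List.drop_suffix _ _).isInfix
  have hle := @hmin (u.take i ++ (u.drop i).take n ++ u.drop (j + n)) ⟨hmem, ?_, ?_⟩
  · simp at hle
    omega
  · rw [ei]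
    refine List.IsPrefix.trans ?_ (List.prefix_append _ _)
    exact List.prefix_of_prefix_length_le hvu (List.take_prefix _ _) (by simp; omega)
  · rw [List.append_assoc, hij, ej]
    refine List.IsSuffix.trans ?_ (List.suffix_append _ _)
    exact List.suffix_of_suffix_length_le hvu' (List.drop_suffix _ _) (by simp; omega)

theorem exists_loop_through {A : Type*} [Finite A] {X : Set (ℤ → A)} (hX : ShiftInvariant X)
    (htrans : LangTransitive X) {n m : ℕ} {v w : List A} (hv : v.length = n)
    (hvX : inLang (sftCover X n) v) (hw : w.length = n + m) (hwX : inLang (sftCover X n) w) :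
    ∃ d : List A,
      d.length ≤ 2 * Nat.card { w : List A // w.length = n ∧ inLang (sftCover X n) w } + m ∧
      inLang (sftCover X n) (v ++ d) ∧ v <:+ v ++ d ∧ w <:+: v ++ d := by
  have hS := shiftInvariant_sftCover X n
  have path : ∀ a b : List A, a.length = n → b.length = n → inLang (sftCover X n) a →
      inLang (sftCover X n) b → ∃ u, inLang (sftCover X n) u ∧ a <+: u ∧ b <:+ u ∧
        u.length < Nat.card { w : List A // w.length = n ∧ inLang (sftCover X n) w } + n := by
    intro a b ha hb haX hbX
    obtain ⟨c, x, hx, hxc⟩ := htrans a b (inLang_of_inLang_sftCover ha.le haX)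
      (inLang_of_inLang_sftCover hb.le hbX)
    exact exists_short_path ha hb ⟨a ++ c ++ b, ⟨x, subset_sftCover hX n hx, hxc⟩,
      by simp [List.append_assoc], List.suffix_append _ _⟩
  obtain ⟨w₀, w', rfl, hw₀⟩ : ∃ w₀ w', w = w₀ ++ w' ∧ w₀.length = n :=
    ⟨w.take n, w.drop n, by simp, by simp; omega⟩
  obtain ⟨w'', w₁, hww, hw₁⟩ : ∃ w'' w₁, w₀ ++ w' = w'' ++ w₁ ∧ w₁.length = n :=
    ⟨(w₀ ++ w').take m, (w₀ ++ w').drop m, by rw [List.take_append_drop],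
      by rw [List.length_drop]; omega⟩
  obtain ⟨_, hu₁, ⟨r₁, rfl⟩, ⟨p₁, hp₁⟩, hl₁⟩ := path v w₀ hv hw₀ hvX
    (hS.inLang_of_infix hwX (List.prefix_append _ _).isInfix)
  obtain ⟨_, hu₂, ⟨r₂, rfl⟩, hs₂, hl₂⟩ := path w₁ v hw₁ hv
    (hS.inLang_of_infix hwX (hww ▸ (List.suffix_append _ _).isInfix)) hvX
  have h₁ : inLang (sftCover X n) (p₁ ++ w₀ ++ w') :=
    inLang_sftCover_append hw₀ (hp₁ ▸ hu₁) hwX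
  have h₂ : inLang (sftCover X n) (p₁ ++ w'' ++ w₁ ++ r₂) := by
    refine inLang_sftCover_append hw₁ ?_ hu₂
    rwa [List.append_assoc, ← hww, ← List.append_assoc]
  have e : v ++ (r₁ ++ w' ++ r₂) = p₁ ++ w'' ++ w₁ ++ r₂ := by
    rw [List.append_assoc p₁, ← hww, ← List.append_assoc p₁, hp₁]
    simp
  refine ⟨r₁ ++ w' ++ r₂, ?_, e ▸ h₂, ?_, ?_⟩
  · simp at hl₁ hl₂ hw ⊢
    omega
  · rw [e, List.append_assoc]
    exact hs₂.trans (List.suffix_append _ _)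
  · rw [e, List.append_assoc p₁, ← hww]
    exact ⟨p₁, r₂, rfl⟩

def insertLoop {A : Type*} (n : ℕ) (D : List A → List A) (p : ℕ) (u : List A) : List A :=
  u.take (p + n) ++ (D ((u.drop p).take n) ++ u.drop (p + n))

theorem take_insertLoop {A : Type*} {n : ℕ} (D : List A → List A) {p : ℕ} {u : List A}
    (hu : p + n ≤ u.length) : (insertLoop n D p u).take (p + n) = u.take (p + n) := by
  rw [insertLoop, List.take_append_of_le_length (by simp; omega), List.take_take, min_self]

theorem insertLoop_injOn {A : Type*} (n : ℕ) (D : List A → List A) (p : ℕ) :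
    Set.InjOn (insertLoop n D p) {u | p + n ≤ u.length} := by
  intro u hu u' hu' h
  have ht : u.take (p + n) = u'.take (p + n) := by
    rw [← take_insertLoop D hu, h, take_insertLoop D hu']
  have hw : (u.drop p).take n = (u'.drop p).take n := by
    rw [List.take_drop, List.take_drop, ht]
  rw [insertLoop, insertLoop, ht, hw] at h
  rw [← List.take_append_drop (p + n) u, ← List.take_append_drop (p + n) u', ht,
    List.append_cancel_left (List.append_cancel_left h)]

theorem inLang_insertLoop {A : Type*} {X : Set (ℤ → A)} {n p : ℕ} {D : List A → List A}
    {u : List A} (hu : p + n ≤ u.length) (huX : inLang (sftCover X n) u)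
    (hD : inLang (sftCover X n) ((u.drop p).take n ++ D ((u.drop p).take n)))
    (hs : (u.drop p).take n <:+ (u.drop p).take n ++ D ((u.drop p).take n)) :
    inLang (sftCover X n) (insertLoop n D p u) := by
  have hS := shiftInvariant_sftCover X n
  have hv : ((u.drop p).take n).length = n := by simp; omega
  obtain ⟨c, hc⟩ := hs
  have e₁ : u.take p ++ (u.drop p).take n = u.take (p + n) := by rw [List.take_add]
  have e₂ : (u.drop p).take n ++ u.drop (p + n) = u.drop p := by
    rw [← List.drop_drop, List.take_append_drop]
  have h₁ := inLang_sftCover_append hv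
    (e₁ ▸ hS.inLang_of_infix huX (List.take_prefix _ _).isInfix) hD
  rw [List.append_assoc, ← hc, ← List.append_assoc] at h₁
  have h₂ := inLang_sftCover_append hv h₁
    (e₂ ▸ hS.inLang_of_infix huX (List.drop_suffix _ _).isInfix)
  rwa [List.append_assoc (u.take p), hc, ← List.append_assoc, e₁, List.append_assoc] at h₂

theorem infix_take_insertLoop {A : Type*} {n p T : ℕ} {D : List A → List A} {u w : List A}
    (hu : p + n ≤ u.length) (hT : (D ((u.drop p).take n)).length ≤ T)
    (hw : w <:+: (u.drop p).take n ++ D ((u.drop p).take n)) :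
    w <:+: (insertLoop n D p u).take (p + n + T) := by
  have e₁ : u.take p ++ (u.drop p).take n = u.take (p + n) := by rw [List.take_add]
  refine (hw.trans (List.suffix_append (u.take p) _).isInfix).trans (List.IsPrefix.isInfix ?_)
  rw [← List.append_assoc, e₁]
  refine List.prefix_of_prefix_length_le (l₃ := insertLoop n D p u) ?_ (List.take_prefix _ _) ?_
  · exact ⟨u.drop (p + n), by simp [insertLoop]⟩
  · simp [insertLoop]
    omega

theorem length_insertLoop {A : Type*} (n : ℕ) (D : List A → List A) (p : ℕ) (u : List A) :
    (insertLoop n D p u).length = u.length + (D ((u.drop p).take n)).length := by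
  simp [insertLoop]
  omega

theorem exists_inserted_words {A : Type*} {X : Set (ℤ → A)} {n T N : ℕ} {w : List A}
    {D : List A → List A}
    (hD : ∀ v : List A, v.length = n → inLang (sftCover X n) v → (D v).length ≤ T ∧
      inLang (sftCover X n) (v ++ D v) ∧ v <:+ v ++ D v ∧ w <:+: v ++ D v)
    {β : ℝ} (hβ : 0 ≤ β) (E₀ : Finset (List A))
    (hE₀ : ∀ u ∈ E₀, inLang (sftCover X n) u ∧ u.length = N ∧ ¬ w <:+: u) (i k : ℕ)
    (hik : n + (i + k) * T ≤ N) :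
    ∃ E : Finset (List A),
      (∀ u ∈ E, inLang (sftCover X n) u ∧ N ≤ u.length ∧ u.length ≤ N + i * T ∧
        ¬ w <:+: u.take (k * T + n)) ∧
      (1 + Real.exp (-β * T)) ^ i * (E₀.card * Real.exp (-β * N)) ≤
        ∑ u ∈ E, Real.exp (-β * u.length) := by
  classical
  induction i generalizing k with
  | zero =>
    refine ⟨E₀, fun u hu => ?_, ?_⟩
    · obtain ⟨h₁, h₂, h₃⟩ := hE₀ u hu
      exact ⟨h₁, h₂.ge, by simp [h₂], fun h => h₃ (h.trans (List.take_prefix _ _).isInfix)⟩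
    · rw [Finset.sum_congr rfl (g := fun _ => Real.exp (-β * N))
        (fun u hu => by rw [(hE₀ u hu).2.1])]
      simp
  | succ i ih =>
    obtain ⟨E, hE, hsum⟩ := ih (k + 1) (by rwa [add_assoc, add_comm 1] at hik)
    have hT : (k + 1) * T = k * T + T := by ring
    have hNT : k * T + n + T ≤ N := by
      have : (i + 1 + k) * T = i * T + k * T + T := by ring
      omega
    have hlen : ∀ u ∈ E, k * T + n ≤ u.length := fun u hu => by have := (hE u hu).2.1; omega
    have hwin : ∀ u ∈ E, ((u.drop (k * T)).take n).length = n ∧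
        inLang (sftCover X n) ((u.drop (k * T)).take n) := fun u hu =>
      ⟨by have := hlen u hu; simp; omega, (shiftInvariant_sftCover X n).inLang_of_infix (hE u hu).1
        ((List.take_prefix _ _).isInfix.trans (List.drop_suffix _ _).isInfix)⟩
    have hdisj : Disjoint E (E.image (insertLoop n D (k * T))) := by
      rw [Finset.disjoint_left]
      intro a ha ha'
      obtain ⟨u, hu, rfl⟩ := Finset.mem_image.1 ha'
      obtain ⟨d₁, -, -, d₄⟩ := hD _ (hwin u hu).1 (hwin u hu).2
      refine (hE _ ha).2.2.2 ?_
      rw [hT, add_right_comm]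
      exact infix_take_insertLoop (hlen u hu) d₁ d₄
    have hsub : ∀ u ∈ E, ¬ w <:+: u.take (k * T + n) := fun u hu h =>
      (hE u hu).2.2.2 (h.trans (List.take_prefix_take_left (by omega)).isInfix)
    refine ⟨E ∪ E.image (insertLoop n D (k * T)), fun a ha => ?_, ?_⟩
    · have hiT : (i + 1) * T = i * T + T := by ring
      rcases Finset.mem_union.1 ha with ha | ha
      · obtain ⟨h₁, h₂, h₃, h₄⟩ := hE a ha
        exact ⟨h₁, h₂, by omega, hsub a ha⟩
      · obtain ⟨u, hu, rfl⟩ := Finset.mem_image.1 ha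
        obtain ⟨d₁, d₂, d₃, d₄⟩ := hD _ (hwin u hu).1 (hwin u hu).2
        obtain ⟨h₁, h₂, h₃, h₄⟩ := hE u hu
        refine ⟨inLang_insertLoop (hlen u hu) h₁ d₂ d₃, ?_, ?_, ?_⟩
        · rw [length_insertLoop]; omega
        · rw [length_insertLoop]; omega
        · rw [take_insertLoop D (hlen u hu)]
          exact hsub u hu
    · rw [Finset.sum_union hdisj, Finset.sum_image
        (fun a ha b hb h => insertLoop_injOn n D (k * T) (hlen a ha) (hlen b hb) h)]
      calc _ = (1 + Real.exp (-β * T)) * ((1 + Real.exp (-β * T)) ^ i *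
              (E₀.card * Real.exp (-β * N))) := by ring
        _ ≤ (1 + Real.exp (-β * T)) * ∑ u ∈ E, Real.exp (-β * u.length) := by gcongr
        _ = ∑ u ∈ E, Real.exp (-β * u.length) +
              ∑ u ∈ E, Real.exp (-β * (u.length + T)) := by
          rw [add_mul, one_mul, Finset.mul_sum]
          congr 1
          refine Finset.sum_congr rfl fun u _ => ?_
          rw [← Real.exp_add]
          ring_nf
        _ ≤ _ := by
          refine add_le_add_right (Finset.sum_le_sum fun u hu => Real.exp_le_exp.2 ?_) _
          rw [length_insertLoop]
          have : ((D ((u.drop (k * T)).take n)).length : ℝ) ≤ T :=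
            mod_cast (hD _ (hwin u hu).1 (hwin u hu).2).1
          push_cast
          nlinarith

/-- The number of words of length `N` in the language of `S`. -/
noncomputable def wordCount {A : Type*} (S : Set (ℤ → A)) (N : ℕ) : ℕ :=
  Nat.card { w : List A // w.length = N ∧ inLang S w }

theorem wordCount_eq_ncard {A : Type*} (S : Set (ℤ → A)) (N : ℕ) :
    wordCount S N = {w : List A | w.length = N ∧ inLang S w}.ncard := rfl

theorem sum_exp_length_le {A : Type*} [Finite A] {S : Set (ℤ → A)} {β : ℝ} {N M : ℕ}
    (hβ : ∀ k, N ≤ k → (wordCount S k : ℝ) ≤ Real.exp (β * k)) (E : Finset (List A))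
    (hE : ∀ u ∈ E, inLang S u ∧ N ≤ u.length ∧ u.length ≤ N + M) :
    ∑ u ∈ E, Real.exp (-β * u.length) ≤ M + 1 := by
  classical
  have hmap : ∀ u ∈ E, u.length ∈ Finset.Icc N (N + M) := fun u hu =>
    Finset.mem_Icc.2 (hE u hu).2
  rw [← Finset.sum_fiberwise_of_maps_to hmap]
  have hk : ∀ k ∈ Finset.Icc N (N + M),
      ∑ u ∈ E with u.length = k, Real.exp (-β * u.length) ≤ 1 := by
    intro k hk
    rw [Finset.sum_congr rfl (g := fun _ => Real.exp (-β * k))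
      (fun u hu => by rw [(Finset.mem_filter.1 hu).2]), Finset.sum_const, nsmul_eq_mul]
    have hcard : (E.filter fun u => u.length = k).card ≤ wordCount S k := by
      rw [wordCount_eq_ncard, ← Set.ncard_coe_finset]
      refine Set.ncard_le_ncard (fun u hu => ?_)
        ((List.finite_length_eq A k).subset fun _ h => h.1)
      obtain ⟨h₁, h₂⟩ := Finset.mem_filter.1 (Finset.mem_coe.1 hu)
      exact ⟨h₂, (hE u h₁).1⟩
    calc ((E.filter fun u => u.length = k).card : ℝ) * Real.exp (-β * k)
        ≤ Real.exp (β * k) * Real.exp (-β * k) := by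
          gcongr
          exact le_trans (mod_cast hcard) (hβ k (Finset.mem_Icc.1 hk).1)
      _ = 1 := by rw [← Real.exp_add]; simp
  refine (Finset.sum_le_sum hk).trans ?_
  simp
  rw [Nat.cast_sub (by omega)]
  push_cast
  linarith

theorem wordCount_mul_pow_le {A : Type*} [Finite A] {X Y : Set (ℤ → A)} {n T N r : ℕ}
    {w : List A} {D : List A → List A}
    (hD : ∀ v : List A, v.length = n → inLang (sftCover X n) v → (D v).length ≤ T ∧
      inLang (sftCover X n) (v ++ D v) ∧ v <:+ v ++ D v ∧ w <:+: v ++ D v)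
    (hY : ∀ u, inLang Y u → inLang (sftCover X n) u ∧ ¬ w <:+: u)
    {β : ℝ} (hβ₀ : 0 ≤ β)
    (hβ : ∀ k, N ≤ k → (wordCount (sftCover X n) k : ℝ) ≤ Real.exp (β * k))
    (hr : n + r * T ≤ N) :
    wordCount Y N * (1 + Real.exp (-β * T)) ^ r ≤ (N + 1) * Real.exp (β * N) := by
  have hfin : {u : List A | u.length = N ∧ inLang Y u}.Finite :=
    (List.finite_length_eq A N).subset fun _ h => h.1
  obtain ⟨E, hE, hsum⟩ := exists_inserted_words hD hβ₀ hfin.toFinset (N := N)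
    (fun u hu => by
      obtain ⟨h₁, h₂⟩ := hfin.mem_toFinset.1 hu
      exact ⟨(hY u h₂).1, h₁, (hY u h₂).2⟩) r 0 (by simpa using hr)
  have hle := hsum.trans (sum_exp_length_le hβ E (M := r * T)
    fun u hu => ⟨(hE u hu).1, (hE u hu).2.1, (hE u hu).2.2.1⟩)
  rw [← Set.ncard_eq_toFinset_card _ hfin, ← wordCount_eq_ncard] at hle
  have hrN : ((r * T : ℕ) : ℝ) ≤ N := mod_cast (by omega)
  calc (wordCount Y N : ℝ) * (1 + Real.exp (-β * T)) ^ r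
      = ((1 + Real.exp (-β * T)) ^ r * (wordCount Y N * Real.exp (-β * N))) *
          Real.exp (β * N) := by
        have : Real.exp (-β * N) * Real.exp (β * N) = 1 := by rw [← Real.exp_add]; simp
        linear_combination (-(wordCount Y N : ℝ) * (1 + Real.exp (-β * T)) ^ r) * this
    _ ≤ (N + 1) * Real.exp (β * N) := by
        gcongr
        linarith

theorem wordCount_pos {A : Type*} [Finite A] {S : Set (ℤ → A)} (hS : S.Nonempty) (N : ℕ) :
    0 < wordCount S N := by
  obtain ⟨x, hx⟩ := hS
  have := finite_words S N
  have : Nonempty { w : List A // w.length = N ∧ inLang S w } :=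
    ⟨⟨_, by simp, x, hx, occursAt_ofFn x 0 N⟩⟩
  exact Nat.card_pos

theorem wordCount_le {A : Type*} [Fintype A] (S : Set (ℤ → A)) (N : ℕ) :
    wordCount S N ≤ Fintype.card A ^ N := by
  rw [← card_vector, ← Nat.card_eq_fintype_card]
  refine Nat.card_le_card_of_injective
    (fun w : { w : List A // w.length = N ∧ inLang S w } => (⟨w.1, w.2.1⟩ : List.Vector A N)) ?_
  intro a b h
  exact Subtype.ext (congrArg List.Vector.toList h)

theorem log_wordCount_div_le {A : Type*} [Fintype A] [Nonempty A] (S : Set (ℤ → A)) (N : ℕ) :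
    Real.log (wordCount S N) / N ≤ Real.log (Fintype.card A) := by
  have hA : (1 : ℝ) ≤ Fintype.card A := mod_cast Fintype.card_pos
  refine div_le_of_le_mul₀ (Nat.cast_nonneg _) (Real.log_nonneg hA) ?_
  rcases Nat.eq_zero_or_pos (wordCount S N) with h | h
  · rw [h, Nat.cast_zero, Real.log_zero]
    exact mul_nonneg (Real.log_nonneg hA) (Nat.cast_nonneg _)
  · rw [mul_comm, ← Real.log_pow]
    exact Real.log_le_log (mod_cast h) (mod_cast wordCount_le S N)

theorem log_wordCount_div_nonneg {A : Type*} (S : Set (ℤ → A)) (N : ℕ) :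
    0 ≤ Real.log (wordCount S N) / N :=
  div_nonneg (Real.log_natCast_nonneg _) (Nat.cast_nonneg _)

theorem subshiftEntropy_eq_limsup {A : Type*} (S : Set (ℤ → A)) :
    subshiftEntropy S = limsup (fun N : ℕ => Real.log (wordCount S N) / N) atTop := rfl

theorem subshiftEntropy_nonneg {A : Type*} [Fintype A] [Nonempty A] (S : Set (ℤ → A)) :
    0 ≤ subshiftEntropy S := by
  rw [subshiftEntropy_eq_limsup]
  exact le_limsup_of_frequently_le
    (Frequently.of_forall fun N => log_wordCount_div_nonneg S N)
    (isBoundedUnder_of ⟨_, log_wordCount_div_le S⟩)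

theorem subshiftEntropy_le {A : Type*} [Fintype A] [Nonempty A] (S : Set (ℤ → A)) :
    subshiftEntropy S ≤ Real.log (Fintype.card A) := by
  rw [subshiftEntropy_eq_limsup]
  exact limsup_le_of_le (isBoundedUnder_of ⟨0, log_wordCount_div_nonneg S⟩).isCoboundedUnder_le
    (Eventually.of_forall (log_wordCount_div_le S))

theorem subshiftEntropy_le_of_tendsto {A : Type*} {S : Set (ℤ → A)} {v : ℕ → ℝ} {c : ℝ}
    (hv : Tendsto v atTop (𝓝 c)) (h : ∀ᶠ N : ℕ in atTop, Real.log (wordCount S N) / N ≤ v N) :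
    subshiftEntropy S ≤ c := by
  rw [subshiftEntropy_eq_limsup, ← hv.limsup_eq]
  exact limsup_le_limsup h
    (isBoundedUnder_of ⟨0, log_wordCount_div_nonneg S⟩).isCoboundedUnder_le hv.isBoundedUnder_le

theorem eventually_wordCount_le_exp {A : Type*} [Fintype A] [Nonempty A] {S : Set (ℤ → A)}
    (hS : S.Nonempty) {β : ℝ} (hβ : subshiftEntropy S < β) :
    ∀ᶠ N : ℕ in atTop, (wordCount S N : ℝ) ≤ Real.exp (β * N) := by
  have := eventually_lt_of_limsup_lt (subshiftEntropy_eq_limsup S ▸ hβ)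
    (isBoundedUnder_of ⟨_, log_wordCount_div_le S⟩)
  filter_upwards [this, eventually_gt_atTop 0] with N hN hN₀
  rw [div_lt_iff₀ (mod_cast hN₀)] at hN
  rw [← Real.log_le_iff_le_exp (mod_cast wordCount_pos hS N)]
  exact hN.le

theorem tendsto_log_succ_div : Tendsto (fun N : ℕ => Real.log (N + 1) / N) atTop (𝓝 0) := by
  have h₁ : Tendsto (fun N : ℕ => Real.log ((N + 1 : ℕ) : ℝ) / ((N + 1 : ℕ) : ℝ)) atTop (𝓝 0) :=
    ((Real.isLittleO_log_id_atTop.tendsto_div_nhds_zero).comp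
      tendsto_natCast_atTop_atTop).comp (tendsto_add_atTop_nat 1)
  have h₂ : Tendsto (fun N : ℕ => 1 + 1 / (N : ℝ)) atTop (𝓝 (1 + 0)) :=
    tendsto_const_nhds.add tendsto_one_div_atTop_nhds_zero_nat
  have h := h₁.mul h₂
  rw [zero_mul] at h
  refine h.congr' ?_
  filter_upwards [eventually_gt_atTop 0] with N hN
  have : (N : ℝ) ≠ 0 := mod_cast hN.ne'
  push_cast
  field_simp

theorem subshiftEntropy_le_of_loops {A : Type*} [Fintype A] [Nonempty A] {X Y : Set (ℤ → A)}
    {n T : ℕ} {w : List A} {D : List A → List A} (hT : 0 < T)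
    (hD : ∀ v : List A, v.length = n → inLang (sftCover X n) v → (D v).length ≤ T ∧
      inLang (sftCover X n) (v ++ D v) ∧ v <:+ v ++ D v ∧ w <:+: v ++ D v)
    (hY₀ : Y.Nonempty) (hY : ∀ u, inLang Y u → inLang (sftCover X n) u ∧ ¬ w <:+: u)
    {β : ℝ} (hβ : subshiftEntropy (sftCover X n) < β) :
    subshiftEntropy Y ≤ β - Real.log (1 + Real.exp (-β * T)) / T := by
  have hX₀ : (sftCover X n).Nonempty := by
    obtain ⟨x, hx⟩ := hY₀
    obtain ⟨⟨y, hy, -⟩, -⟩ := hY [] ⟨x, hx, occursAt_iff.2 (by simp)⟩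
    exact ⟨y, hy⟩
  have hβ₀ : 0 ≤ β := (subshiftEntropy_nonneg _).trans hβ.le
  obtain ⟨N₀, hN₀⟩ := eventually_atTop.1 (eventually_wordCount_le_exp hX₀ hβ)
  set L := Real.log (1 + Real.exp (-β * T)) with hL
  have hL₀ : 0 ≤ L := Real.log_nonneg (by linarith [Real.exp_pos (-β * T)])
  have hlim : Tendsto (fun N : ℕ => Real.log (N + 1) / N + (β - L / T) + (n / T + 1) * L / N)
      atTop (𝓝 (0 + (β - L / T) + 0)) :=
    (tendsto_log_succ_div.add tendsto_const_nhds).add (tendsto_const_div_atTop_nhds_zero_nat _)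
  rw [zero_add, add_zero] at hlim
  refine subshiftEntropy_le_of_tendsto hlim ?_
  filter_upwards [eventually_ge_atTop N₀, eventually_ge_atTop n, eventually_gt_atTop 0]
    with N hN hNn hNpos
  have hT' : (0 : ℝ) < T := mod_cast hT
  have hN' : (0 : ℝ) < N := mod_cast hNpos
  have hr : n + (N - n) / T * T ≤ N := by
    have := Nat.div_mul_le_self (N - n) T
    omega
  have hr' : ((N : ℝ) - n) / T - 1 ≤ ((N - n) / T : ℕ) := by
    rw [sub_le_iff_le_add, div_le_iff₀ hT']
    have := Nat.lt_div_mul_add hT (a := N - n)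
    have h : N ≤ ((N - n) / T + 1) * T + n := by rw [add_mul]; omega
    have : (N : ℝ) ≤ (((N - n) / T : ℕ) + 1) * T + n := mod_cast h
    linarith
  have hcount := wordCount_mul_pow_le hD hY hβ₀ (fun k hk => hN₀ k (hN.trans hk)) hr
  have hpos : (0 : ℝ) < wordCount Y N := mod_cast wordCount_pos hY₀ N
  have hlog := Real.log_le_log (by positivity) hcount
  rw [Real.log_mul (by positivity) (by positivity), Real.log_mul (by positivity) (by positivity),
    Real.log_pow, Real.log_exp, ← hL] at hlog
  rw [div_le_iff₀ hN']
  have e : (Real.log (N + 1) / N + (β - L / T) + (n / T + 1) * L / N) * N =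
      Real.log (N + 1) + β * N - (((N : ℝ) - n) / T - 1) * L := by
    field_simp
    ring
  rw [e]
  linarith [mul_le_mul_of_nonneg_right hr' hL₀]

theorem subshiftEntropy_gap_of_loops {A : Type*} [Fintype A] [Nonempty A] {X Y : Set (ℤ → A)}
    {n T : ℕ} {w : List A} {D : List A → List A} (hT : 0 < T)
    (hD : ∀ v : List A, v.length = n → inLang (sftCover X n) v → (D v).length ≤ T ∧
      inLang (sftCover X n) (v ++ D v) ∧ v <:+ v ++ D v ∧ w <:+: v ++ D v)
    (hY₀ : Y.Nonempty) (hY : ∀ u, inLang Y u → inLang (sftCover X n) u ∧ ¬ w <:+: u) :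
    Real.log (1 + Real.exp (-(Real.log (Fintype.card A) + 1) * T)) / T ≤
      subshiftEntropy (sftCover X n) - subshiftEntropy Y := by
  rw [le_sub_iff_add_le, ← le_sub_iff_add_le']
  suffices h : ∀ β, subshiftEntropy (sftCover X n) < β →
      β < subshiftEntropy (sftCover X n) + 1 →
      subshiftEntropy Y +
        Real.log (1 + Real.exp (-(Real.log (Fintype.card A) + 1) * T)) / T ≤ β by
    have := le_of_forall_gt_imp_ge_of_dense (a₁ := subshiftEntropy Y +
      Real.log (1 + Real.exp (-(Real.log (Fintype.card A) + 1) * T)) / T)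
      (a₂ := subshiftEntropy (sftCover X n)) fun β hβ => ?_
    · linarith
    · rcases lt_or_ge β (subshiftEntropy (sftCover X n) + 1) with h' | h'
      · exact h β hβ h'
      · exact (h (subshiftEntropy (sftCover X n) + 1 / 2) (by linarith) (by linarith)).trans
          (by linarith)
  intro β hβ hβ'
  have h₁ := subshiftEntropy_le_of_loops hT hD hY₀ hY hβ
  have h₂ := subshiftEntropy_le (sftCover X n)
  have h₃ : Real.log (1 + Real.exp (-(Real.log (Fintype.card A) + 1) * T)) / T ≤
      Real.log (1 + Real.exp (-β * T)) / T := by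
    gcongr
    linarith
  linarith

theorem le_xi {s : ℕ} (hs : 1 ≤ s) : 30 * (s : ℝ) ^ (3 * (s ^ 2 + 1)) ≤ xi s := by
  have hs' : (1 : ℝ) ≤ s := mod_cast hs
  have hp : (1 : ℝ) ≤ (s : ℝ) ^ (2 * s ^ 2) := one_le_pow₀ hs'
  have h₁ : 1 / (4 * (s : ℝ) ^ (2 * s ^ 2)) ≤ 1 := by
    rw [div_le_one (by positivity)]
    linarith
  have h₂ : 0 < 1 / (4 * (s : ℝ) ^ (2 * s ^ 2)) := by positivity
  have h₃ : (1 - 1 / (4 * (s : ℝ) ^ (2 * s ^ 2))) ^ (1 / (s ^ 2 : ℝ)) < 1 :=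
    Real.rpow_lt_one (by linarith) (by linarith) (by positivity)
  have h₄ : 0 ≤ (1 - 1 / (4 * (s : ℝ) ^ (2 * s ^ 2))) ^ (1 / (s ^ 2 : ℝ)) :=
    Real.rpow_nonneg (by linarith) _
  simp only [xi, Real.rpow_eq_pow]
  rw [le_div_iff₀ (by linarith)]
  exact mul_le_of_le_one_right (by positivity) (by linarith)

theorem pow_self_le_xi_sq {s : ℕ} (hs : 1 ≤ s) : (s : ℝ) ^ s ≤ xi s ^ 2 := by
  have hs' : (1 : ℝ) ≤ s := mod_cast hs
  have h₀ : (s : ℝ) ^ s ≤ (s : ℝ) ^ (3 * (s ^ 2 + 1)) := pow_le_pow_right₀ hs' (by nlinarith)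
  have h₁ : (1 : ℝ) ≤ (s : ℝ) ^ s := one_le_pow₀ hs'
  have h₂ := le_xi hs
  nlinarith

theorem pow_le_pow_self_mul {B s : ℕ} (hB : 1 ≤ B) (hs : 1 ≤ s) : B ^ s ≤ B ^ B * s ^ s := by
  rcases le_total B s with h | h
  · exact (Nat.pow_le_pow_left h s).trans (Nat.le_mul_of_pos_left _ (by positivity))
  · exact (Nat.pow_le_pow_right hB h).trans (Nat.le_mul_of_pos_right _ (by positivity))

theorem exists_le_log_one_add_exp_div (γ : ℝ) (m : ℕ) :
    ∃ c : ℝ, 0 < c ∧ ∀ s : ℕ, 1 ≤ s →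
      c / xi s ^ 2 ≤
        Real.log (1 + Real.exp (-γ * (2 * s + m : ℕ))) / (2 * s + m : ℕ) := by
  obtain ⟨q, hq⟩ := exists_nat_ge (4 * (1 + Real.exp γ))
  have hq₁ : 1 ≤ q := by
    have : (1 : ℝ) ≤ q := by linarith [Real.exp_pos γ]
    exact_mod_cast this
  set B := q ^ 2 with hB
  refine ⟨1 / (q ^ m * B ^ B : ℕ), by positivity, fun s hs => ?_⟩
  set T := 2 * s + m with hT
  have hT₀ : 0 < T := by omega
  have hT' : (0 : ℝ) < T := mod_cast hT₀
  have hpow : ((q ^ T : ℕ) : ℝ) ≤ (q ^ m * B ^ B : ℕ) * xi s ^ 2 := by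
    have h : q ^ T ≤ q ^ m * B ^ B * s ^ s := by
      rw [hT, pow_add, pow_mul, ← hB, mul_comm, mul_assoc]
      exact Nat.mul_le_mul_left _ (pow_le_pow_self_mul (Nat.one_le_pow _ _ hq₁) hs)
    calc ((q ^ T : ℕ) : ℝ) ≤ (q ^ m * B ^ B * s ^ s : ℕ) := mod_cast h
      _ = (q ^ m * B ^ B : ℕ) * (s : ℝ) ^ s := by push_cast; ring
      _ ≤ _ := by gcongr; exact pow_self_le_xi_sq hs
  have hTq : (T : ℝ) * (1 + Real.exp (γ * T)) ≤ (q ^ T : ℕ) := by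
    have h₁ : (T : ℝ) ≤ 2 ^ T := mod_cast Nat.lt_two_pow_self.le
    have h₂ : 1 + Real.exp (γ * T) ≤ 2 ^ T * (1 + Real.exp γ) ^ T := by
      have e : Real.exp (γ * T) = Real.exp γ ^ T := by rw [← Real.exp_nat_mul, mul_comm]
      have h₃ : Real.exp γ ^ T ≤ (1 + Real.exp γ) ^ T := by gcongr; linarith
      have h₄ : 1 ≤ (1 + Real.exp γ) ^ T := one_le_pow₀ (by linarith [Real.exp_pos γ])
      have h₅ : (2 : ℝ) ≤ 2 ^ T := le_self_pow₀ (by norm_num) hT₀.ne'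
      rw [e]
      nlinarith
    calc (T : ℝ) * (1 + Real.exp (γ * T)) ≤ 2 ^ T * (2 ^ T * (1 + Real.exp γ) ^ T) := by gcongr
      _ = (4 * (1 + Real.exp γ)) ^ T := by
        rw [← mul_assoc, ← mul_pow, ← mul_pow]
        norm_num
      _ ≤ (q ^ T : ℕ) := by
        push_cast
        gcongr
  have hlog : 1 / (1 + Real.exp (γ * T)) ≤ Real.log (1 + Real.exp (-γ * T)) := by
    have h := Real.one_sub_inv_le_log_of_pos (x := 1 + Real.exp (-γ * T)) (by positivity)
    refine le_trans (le_of_eq ?_) h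
    rw [neg_mul, Real.exp_neg]
    field_simp
    ring
  have hqT : (0 : ℝ) < (q ^ T : ℕ) := by positivity
  calc 1 / ((q ^ m * B ^ B : ℕ) : ℝ) / xi s ^ 2 = 1 / ((q ^ m * B ^ B : ℕ) * xi s ^ 2) := by
        rw [div_div]
    _ ≤ 1 / (T * (1 + Real.exp (γ * T))) :=
        one_div_le_one_div_of_le (by positivity) (hTq.trans hpow)
    _ = 1 / (1 + Real.exp (γ * T)) / T := by rw [div_div, mul_comm]
    _ ≤ _ := by gcongr

theorem exists_word_of_sftCover_ne {A : Type*} {X : Set (ℤ → A)} (hX : ShiftInvariant X) {n m : ℕ}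
    (h : sftCover X n ≠ sftCover X (n + m)) :
    ∃ w : List A, w.length = n + m ∧ inLang (sftCover X n) w ∧ ¬ inLang X w := by
  have hsub : sftCover X (n + m) ⊆ sftCover X n := fun x hx i w hw =>
    hx i w (hw.trans (Nat.le_add_right _ _))
  obtain ⟨x, hx, hxm⟩ := Set.not_subset.1 fun hsub' => h (hsub'.antisymm hsub)
  simp only [sftCover, Set.mem_ofPred_eq, not_forall] at hxm
  obtain ⟨i, w, hw, hxw, hwX⟩ := hxm
  refine ⟨_, List.length_ofFn, (shiftInvariant_sftCover X n).inLang_of_occursAt hx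
    (occursAt_ofFn x i (n + m)), fun hX' => hwX (hX.inLang_of_infix hX' ?_)⟩
  refine List.IsPrefix.isInfix (List.prefix_iff_getElem.2 ⟨by simpa using hw, fun j hj => ?_⟩)
  rw [List.getElem_ofFn]
  exact (occursAt_iff.1 hxw j hj).symm

theorem sftCover_gap {A : Type*} [Fintype A] [Nonempty A] {X : Set (ℤ → A)} (hX₀ : X.Nonempty)
    (hX : ShiftInvariant X) (htrans : LangTransitive X) {n m : ℕ}
    (h : sftCover X n ≠ sftCover X (n + m)) :
    Real.log (1 + Real.exp (-(Real.log (Fintype.card A) + 1) *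
        (2 * wordCount (sftCover X n) n + m : ℕ))) / (2 * wordCount (sftCover X n) n + m : ℕ) ≤
      subshiftEntropy (sftCover X n) - subshiftEntropy (sftCover X (n + m)) := by
  obtain ⟨w, hw, hwn, hwX⟩ := exists_word_of_sftCover_ne hX h
  have hloop : ∀ v : List A, ∃ d : List A, v.length = n → inLang (sftCover X n) v →
      d.length ≤ 2 * wordCount (sftCover X n) n + m ∧ inLang (sftCover X n) (v ++ d) ∧
        v <:+ v ++ d ∧ w <:+: v ++ d := by
    intro v
    by_cases hv : v.length = n ∧ inLang (sftCover X n) v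
    · obtain ⟨d, hd⟩ := exists_loop_through hX htrans hv.1 hv.2 hw hwn
      exact ⟨d, fun _ _ => hd⟩
    · exact ⟨[], fun h₁ h₂ => absurd ⟨h₁, h₂⟩ hv⟩
  choose D hD using hloop
  have hpos := wordCount_pos (hX₀.mono (subset_sftCover hX n)) n
  refine subshiftEntropy_gap_of_loops (by omega) hD (hX₀.mono (subset_sftCover hX (n + m)))
    fun u hu => ⟨?_, fun hwu => hwX ?_⟩
  · obtain ⟨x, hx, hxu⟩ := hu
    exact ⟨x, fun i v hv => hx i v (hv.trans (Nat.le_add_right _ _)), hxu⟩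
  · exact inLang_of_inLang_sftCover hw.le
      ((shiftInvariant_sftCover X (n + m)).inLang_of_infix hu hwu)

theorem language_stable_iff_entropy_stable {A : Type*} [Fintype A]
    [TopologicalSpace A] [DiscreteTopology A]
    (X : Set (ℤ → A)) (hX : IsSubshift X) (htrans : LangTransitive X) :
    LanguageStable X ↔ EntropyStable X := by
  obtain ⟨hX₀, -, himage⟩ := hX
  have hinv := shiftInvariant_of_image_eq himage
  have : Nonempty A := hX₀.elim fun x _ => ⟨x 0⟩
  have hcount : ∀ n, 1 ≤ wordCount (sftCover X n) n := fun n =>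
    wordCount_pos (hX₀.mono (subset_sftCover hinv n)) n
  constructor
  · intro hL ε hε ℓ j _ _
    obtain ⟨n, hn⟩ := hL j
    refine ⟨n, ?_⟩
    have hxi : 0 < xi (wordCount (sftCover X n) n) :=
      lt_of_lt_of_le (by have := hcount n; positivity) (le_xi (hcount n))
    change _ < ε ^ 2 / ((4 / 3 : ℝ) ^ (2 * ℓ) * xi (wordCount (sftCover X n) n) ^ 2)
    rw [← hn, sub_self, abs_zero]
    positivity
  · intro hE m
    rcases Nat.eq_zero_or_pos m with rfl | hm
    · exact ⟨0, rfl⟩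
    obtain ⟨c, hc, hgap⟩ := exists_le_log_one_add_exp_div (Real.log (Fintype.card A) + 1) m
    obtain ⟨n, hn⟩ := hE (4 / 3 * √c) (by positivity) 1 m le_rfl hm
    refine ⟨n, by_contra fun hne => ?_⟩
    change _ < (4 / 3 * √c) ^ 2 /
      ((4 / 3 : ℝ) ^ (2 * 1) * xi (wordCount (sftCover X n) n) ^ 2) at hn
    rw [mul_pow, Real.sq_sqrt hc.le, mul_one, mul_div_mul_left _ _ (by norm_num)] at hn
    exact absurd hn (not_lt.2 ((hgap _ (hcount n)).trans
      ((sftCover_gap hX₀ hinv htrans hne).trans (le_abs_self _))))
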